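/- Let S be the set of (λ, μ) in ℤ[1/2]ˣ × ℤ[1/2]ˣ with λ + μ = 1. Then S = {(2, -1), (-1, 2), (1/2, 1/2)}, and every element (λ, μ) of S satisfies max(|v₂(λ)|, |v₂(μ)|) ≤ 1, where v₂ denotes the 2-adic valuation. -/

import Mathlib

/-- The only powers of two with consecutive values are `1` and `2`. -/
theorem two_zpow_eq_two_zpow_add_one {a b : ℤ} (h : (2 : ℚ) ^ a = 2 ^ b + 1) :
    a = 1 ∧ b = 0 := by
  have hb_pos : (0 : ℚ) < 2 ^ b := by positivity
  have ha : 0 < a := (one_lt_zpow_iff_right₀ (one_lt_two (α := ℚ))).mp (by linarith)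
  have hb : 0 ≤ b := by
    by_contra! hneg
    have hlt : (2 : ℚ) ^ b < 1 := zpow_lt_one_of_neg₀ one_lt_two hneg
    have : (2 : ℚ) ^ a < 2 ^ (1 : ℤ) := by rw [zpow_one]; linarith
    have := (zpow_lt_zpow_iff_right₀ (one_lt_two (α := ℚ))).mp this
    omega
  lift a to ℕ using ha.le
  lift b to ℕ using hb
  have hN : 2 ^ a = 2 ^ b + 1 := by exact_mod_cast h
  obtain ⟨c, rfl⟩ := Nat.exists_eq_succ_of_ne_zero (n := a) (by omega)
  rcases b with _ | d
  · have : 2 ^ (c + 1) = 2 ^ 1 := hN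
    have := Nat.pow_right_injective le_rfl this
    omega
  · rw [pow_succ, pow_succ] at hN
    omega

theorem two_zpow_add_two_zpow_eq_one {a b : ℤ} (h : (2 : ℚ) ^ a + 2 ^ b = 1) :
    a = -1 ∧ b = -1 := by
  have key : (2 : ℚ) ^ (-b) = 2 ^ (a - b) + 1 := by
    rw [zpow_neg, zpow_sub₀ two_ne_zero]
    field_simp
    exact h.symm
  have := two_zpow_eq_two_zpow_add_one key
  omega

theorem sUnit_equation_two {x y : ℚ} (hx : ∃ k : ℤ, x = 2 ^ k ∨ x = -(2 ^ k))
    (hy : ∃ k : ℤ, y = 2 ^ k ∨ y = -(2 ^ k)) (hxy : x + y = 1) :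
    (x = 2 ∧ y = -1) ∨ (x = -1 ∧ y = 2) ∨ (x = 1 / 2 ∧ y = 1 / 2) := by
  obtain ⟨a, rfl | rfl⟩ := hx <;> obtain ⟨b, rfl | rfl⟩ := hy
  · obtain ⟨rfl, rfl⟩ := two_zpow_add_two_zpow_eq_one hxy
    norm_num
  · obtain ⟨rfl, rfl⟩ := two_zpow_eq_two_zpow_add_one (a := a) (b := b) (by linarith)
    norm_num
  · obtain ⟨rfl, rfl⟩ := two_zpow_eq_two_zpow_add_one (a := b) (b := a) (by linarith)
    norm_num
  · have ha : (0 : ℚ) < 2 ^ a := by positivity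
    have hb : (0 : ℚ) < 2 ^ b := by positivity
    linarith


/-- The S-unit equation λ + μ = 1 in ℤ[1/2]ˣ has exactly the solutions
(2,-1), (-1,2), (1/2,1/2), and each satisfies max(|v₂(λ)|,|v₂(μ)|) ≤ 1. -/
theorem stmt_17 :
    ({lm : ℚ × ℚ | (∃ k : ℤ, lm.1 = 2 ^ k ∨ lm.1 = -(2 ^ k)) ∧
        (∃ k : ℤ, lm.2 = 2 ^ k ∨ lm.2 = -(2 ^ k)) ∧ lm.1 + lm.2 = 1} =
      {((2 : ℚ), (-1 : ℚ)), ((-1 : ℚ), (2 : ℚ)), ((1 / 2 : ℚ), (1 / 2 : ℚ))}) ∧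
    ∀ lm : ℚ × ℚ,
      ((∃ k : ℤ, lm.1 = 2 ^ k ∨ lm.1 = -(2 ^ k)) ∧
        (∃ k : ℤ, lm.2 = 2 ^ k ∨ lm.2 = -(2 ^ k)) ∧ lm.1 + lm.2 = 1) →
      max |padicValRat 2 lm.1| |padicValRat 2 lm.2| ≤ 1 := by
  refine ⟨?_, ?_⟩
  · ext ⟨x, y⟩
    simp only [Set.mem_ofPred_eq, Set.mem_insert_iff, Set.mem_singleton_iff, Prod.mk.injEq]
    refine ⟨fun ⟨hx, hy, hxy⟩ => sUnit_equation_two hx hy hxy, ?_⟩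
    rintro (⟨rfl, rfl⟩ | ⟨rfl, rfl⟩ | ⟨rfl, rfl⟩)
    · exact ⟨⟨1, by norm_num⟩, ⟨0, by norm_num⟩, by norm_num⟩
    · exact ⟨⟨0, by norm_num⟩, ⟨1, by norm_num⟩, by norm_num⟩
    · exact ⟨⟨-1, by norm_num⟩, ⟨-1, by norm_num⟩, by norm_num⟩
  · rintro ⟨x, y⟩ ⟨hx, hy, hxy⟩
    have h_two : padicValRat 2 (2 : ℚ) = 1 := by
      exact_mod_cast padicValRat.self (p := 2) one_lt_two
    have h_half : padicValRat 2 (1 / 2 : ℚ) = -1 := by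
      rw [one_div, padicValRat.inv, h_two]
    obtain ⟨h₁, h₂⟩ | ⟨h₁, h₂⟩ | ⟨h₁, h₂⟩ := sUnit_equation_two hx hy hxy <;>
      simp only at h₁ h₂ <;> simp only [h₁, h₂, h_two, h_half, padicValRat.neg, padicValRat.one] <;>
      norm_num
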